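/- Let B be a k-domain. For every i ∈ ℕ and every k-algebra automorphism α of B, one has α(AL_i(B)) = AL_i(B); that is, each subalgebra AL_i(B) is invariant under all algebraic k-automorphisms of B. -/

import Mathlib

variable {k B : Type*}

/-- A locally nilpotent `k`-derivation. -/
def IsLND [CommRing k] [CommRing B] [Algebra k B] (D : Derivation k B B) : Prop :=
  ∀ a : B, ∃ n : ℕ, ((D.toLinearMap : Module.End k B) ^ n) a = 0

/-- The `AL_i`-invariant: the `k`-subalgebra of `B` generated by `ker ∂^{i+1}` for all
nonzero locally nilpotent derivations `∂` of `B`. -/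
def ALi (k B : Type*) [CommRing k] [CommRing B] [Algebra k B] (i : ℕ) : Subalgebra k B :=
  Algebra.adjoin k {b : B | ∃ D : Derivation k B B, IsLND D ∧ D ≠ 0 ∧
    ((D.toLinearMap : Module.End k B) ^ (i + 1)) b = 0}

/-- The conjugate `α ∘ D ∘ α⁻¹` of a derivation by an algebra automorphism. -/
def Derivation.conjAlgEquiv [CommRing k] [CommRing B] [Algebra k B] (α : B ≃ₐ[k] B)
    (D : Derivation k B B) : Derivation k B B :=
  Derivation.mk' (α.toLinearMap ∘ₗ D.toLinearMap ∘ₗ α.symm.toLinearMap) fun a b => by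
    simp

theorem Derivation.conjAlgEquiv_apply [CommRing k] [CommRing B] [Algebra k B] (α : B ≃ₐ[k] B)
    (D : Derivation k B B) (b : B) : D.conjAlgEquiv α b = α (D (α.symm b)) := rfl

theorem Derivation.conjAlgEquiv_pow_apply [CommRing k] [CommRing B] [Algebra k B]
    (α : B ≃ₐ[k] B) (D : Derivation k B B) (n : ℕ) (b : B) :
    (((D.conjAlgEquiv α).toLinearMap : Module.End k B) ^ n) (α b) =
      α (((D.toLinearMap : Module.End k B) ^ n) b) := by
  induction n with
  | zero => simp
  | succ n ih =>
    rw [pow_succ', pow_succ', Module.End.mul_apply, Module.End.mul_apply, ih]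
    simp [Derivation.conjAlgEquiv_apply]

theorem IsLND.conjAlgEquiv [CommRing k] [CommRing B] [Algebra k B] {D : Derivation k B B}
    (hD : IsLND D) (α : B ≃ₐ[k] B) : IsLND (D.conjAlgEquiv α) := fun a => by
  obtain ⟨n, hn⟩ := hD (α.symm a)
  refine ⟨n, ?_⟩
  rw [← α.apply_symm_apply a, Derivation.conjAlgEquiv_pow_apply, hn, map_zero]

theorem Derivation.conjAlgEquiv_ne_zero [CommRing k] [CommRing B] [Algebra k B]
    {D : Derivation k B B} (hD : D ≠ 0) (α : B ≃ₐ[k] B) : D.conjAlgEquiv α ≠ 0 := by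
  refine fun h => hD (Derivation.ext fun b => α.injective ?_)
  simpa [Derivation.conjAlgEquiv_apply] using DFunLike.congr_fun h (α b)

theorem ALi_map_le [CommRing k] [CommRing B] [Algebra k B] (i : ℕ) (α : B ≃ₐ[k] B) :
    (ALi k B i).map α.toAlgHom ≤ ALi k B i := by
  rw [ALi, AlgHom.map_adjoin]
  refine Algebra.adjoin_mono ?_
  rintro _ ⟨b, ⟨D, hD, hD0, hb⟩, rfl⟩
  refine ⟨D.conjAlgEquiv α, hD.conjAlgEquiv α, Derivation.conjAlgEquiv_ne_zero hD0 α, ?_⟩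
  exact (Derivation.conjAlgEquiv_pow_apply α D (i + 1) b).trans (by rw [hb, map_zero])

theorem stmt6 [Field k] [CharZero k] [CommRing B] [IsDomain B] [Algebra k B]
    (i : ℕ) (α : B ≃ₐ[k] B) :
    (ALi k B i).map α.toAlgHom = ALi k B i := by
  refine (ALi_map_le i α).antisymm fun b hb => ?_
  exact ⟨α.symm b, ALi_map_le i α.symm ⟨b, hb, rfl⟩, α.apply_symm_apply b⟩
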